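/- Let (Ω, 𝔽, ℙ) be a probability space, let φ : Ω → ℝ^d be a random vector with 𝔼[φ φ^⊤] well defined (all products φ_i φ_j integrable), and let Σ : Ω → ℝ^{n×n} be a random symmetric matrix, with all entries of φφ^⊤ ⊗ Σ integrable, such that Σ(ω) ⪰ C almost surely for a fixed symmetric positive semidefinite matrix C ∈ ℝ^{n×n} (Loewner order). Then 𝔼[(φ φ^⊤) ⊗ Σ] ⪰ 𝔼[φ φ^⊤] ⊗ C. Moreover, if 𝔼[φ φ^⊤] is positive definite and C is positive definite, then 𝔼[(φ φ^⊤) ⊗ Σ] is positive definite. -/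

import Mathlib

open Matrix MeasureTheory
open scoped Kronecker

/-- The entrywise integral of an almost surely positive semidefinite random matrix is
positive semidefinite. -/
theorem Matrix.PosSemidef.of_integral {Ω ι : Type*} [MeasurableSpace Ω] [Fintype ι]
    {μ : Measure Ω} {A : Ω → Matrix ι ι ℝ} (hA : ∀ i j, Integrable (fun ω => A ω i j) μ)
    (hpos : ∀ᵐ ω ∂μ, (A ω).PosSemidef) :
    (Matrix.of fun i j => ∫ ω, A ω i j ∂μ).PosSemidef := by
  refine .of_dotProduct_mulVec_nonneg ?_ fun x => ?_
  · ext i j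
    refine integral_congr_ae ?_
    filter_upwards [hpos] with ω hω using hω.isHermitian.apply i j
  · have hquad : star x ⬝ᵥ ((Matrix.of fun i j => ∫ ω, A ω i j ∂μ) *ᵥ x) =
        ∫ ω, star x ⬝ᵥ (A ω *ᵥ x) ∂μ := by
      simp only [dotProduct, mulVec, of_apply]
      rw [integral_finsetSum _ fun i _ =>
        (integrable_finsetSum _ fun j _ => (hA i j).mul_const (x j)).const_mul _]
      refine Finset.sum_congr rfl fun i _ => ?_
      rw [integral_const_mul, integral_finsetSum _ fun j _ => (hA i j).mul_const (x j)]
      simp only [integral_mul_const]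
    rw [hquad]
    refine integral_nonneg_of_ae ?_
    filter_upwards [hpos] with ω hω using hω.dotProduct_mulVec_nonneg x

/-- The Kronecker expectation bound from the proof of Lemma 2 of the paper:
if `Σ(ω) ⪰ C` almost surely (Loewner order), then
`𝔼[(φ φᵀ) ⊗ Σ] ⪰ 𝔼[φ φᵀ] ⊗ C`; moreover if `𝔼[φ φᵀ]` and `C` are positive definite then
`𝔼[(φ φᵀ) ⊗ Σ]` is positive definite. -/
theorem kronecker_expectation_loewner {Ω : Type*} [MeasurableSpace Ω]
    (μ : Measure Ω) [IsProbabilityMeasure μ]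
    {d n : ℕ} (φ : Ω → Fin d → ℝ) (S : Ω → Matrix (Fin n) (Fin n) ℝ)
    (C : Matrix (Fin n) (Fin n) ℝ) (hC : C.PosSemidef)
    (hφφ : ∀ i j, Integrable (fun ω => φ ω i * φ ω j) μ)
    (hint : ∀ (i j : Fin d) (k l : Fin n), Integrable (fun ω => φ ω i * φ ω j * S ω k l) μ)
    (hsym : ∀ᵐ ω ∂μ, (S ω).IsHermitian)
    (hS : ∀ᵐ ω ∂μ, (S ω - C).PosSemidef) :
    ((Matrix.of fun (pq : Fin d × Fin n) (rs : Fin d × Fin n) =>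
        ∫ ω, φ ω pq.1 * φ ω rs.1 * S ω pq.2 rs.2 ∂μ)
      - (Matrix.of fun i j => ∫ ω, φ ω i * φ ω j ∂μ) ⊗ₖ C).PosSemidef ∧
    ((Matrix.of fun i j => ∫ ω, φ ω i * φ ω j ∂μ).PosDef → C.PosDef →
      (Matrix.of fun (pq : Fin d × Fin n) (rs : Fin d × Fin n) =>
        ∫ ω, φ ω pq.1 * φ ω rs.1 * S ω pq.2 rs.2 ∂μ).PosDef) := by
  have hle : ((Matrix.of fun (pq : Fin d × Fin n) (rs : Fin d × Fin n) =>
        ∫ ω, φ ω pq.1 * φ ω rs.1 * S ω pq.2 rs.2 ∂μ)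
      - (Matrix.of fun i j => ∫ ω, φ ω i * φ ω j ∂μ) ⊗ₖ C).PosSemidef := by
    have hpos : ∀ᵐ ω ∂μ, (vecMulVec (φ ω) (φ ω) ⊗ₖ (S ω - C)).PosSemidef := by
      filter_upwards [hS] with ω hω
      exact (posSemidef_vecMulVec_self_star (φ ω)).kronecker hω
    have hA : ∀ p q : Fin d × Fin n,
        Integrable (fun ω => (vecMulVec (φ ω) (φ ω) ⊗ₖ (S ω - C)) p q) μ := fun p q => by
      simp only [kroneckerMap_apply, vecMulVec_apply, Matrix.sub_apply, mul_sub]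
      exact (hint p.1 q.1 p.2 q.2).sub ((hφφ p.1 q.1).mul_const (C p.2 q.2))
    convert PosSemidef.of_integral hA hpos using 1
    ext p q
    simp only [kroneckerMap_apply, vecMulVec_apply, Matrix.sub_apply, of_apply, mul_sub]
    rw [integral_sub (hint p.1 q.1 p.2 q.2) ((hφφ p.1 q.1).mul_const (C p.2 q.2)),
      integral_mul_const]
  refine ⟨hle, fun hφ hC' => ?_⟩
  simpa only [sub_add_cancel] using PosDef.posSemidef_add hle (hφ.kronecker hC')
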